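/- For every δ > 0, the Haar measure λ does not belong to the closed convex hull of the set K_δ = {μ : μ is an invariant probability measure on 𝕋 and the Lévy–Prokhorov distance from μ to λ is at least δ}. -/

import Mathlib

open MeasureTheory

noncomputable section

/-- The circle `[0,1]` with endpoints identified. -/
abbrev 𝕋 := AddCircle (1 : ℝ)

instance : IsProbabilityMeasure (volume : Measure 𝕋) :=
  ⟨by simp [AddCircle.measure_univ]⟩

/-- The doubling map. -/
def T (x : 𝕋) : 𝕋 := 2 • x

/-- The tripling map. -/
def S (x : 𝕋) : 𝕋 := 3 • x

/-- A set is invariant if it is forward invariant under both `T` and `S`. -/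
def Invariant (O : Set 𝕋) : Prop := T '' O ⊆ O ∧ S '' O ⊆ O

/-- A nonempty finite invariant set is minimal if every nonempty invariant subset equals it. -/
def MinimalInvariant (O : Set 𝕋) : Prop :=
  O.Nonempty ∧ O.Finite ∧ Invariant O ∧
    ∀ O' ⊆ O, O'.Nonempty → Invariant O' → O' = O

/-- A measure is invariant if both `T` and `S` are measure preserving for it. -/
def InvariantMeasure (μ : Measure 𝕋) : Prop :=
  MeasurePreserving T μ μ ∧ MeasurePreserving S μ μ

/-- The normalized counting measure on a set: each point of a finite set `O`
gets mass `1 / |O|`. -/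
def normCount (O : Set 𝕋) : Measure 𝕋 :=
  (O.ncard : ENNReal)⁻¹ • Measure.count.restrict O

/-- `Fn n` is the set of points `i/n` of the circle with `0 < i < n`. -/
def Fn (n : ℕ) : Set 𝕋 := {x : 𝕋 | ∃ i : ℕ, 0 < i ∧ i < n ∧ x = ((i : ℝ) / n : ℝ)}

/-- The set of finite convex combinations of elements of a set of probability measures. -/
def convexCombinations (K : Set (ProbabilityMeasure 𝕋)) : Set (ProbabilityMeasure 𝕋) :=
  {ν | ∃ (k : ℕ) (w : Fin k → ENNReal) (μs : Fin k → ProbabilityMeasure 𝕋),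
    (∀ i, μs i ∈ K) ∧ (∑ i, w i = 1) ∧
    (ν : Measure 𝕋) = ∑ i, w i • (μs i : Measure 𝕋)}

open Filter Topology

theorem integral_fourier_of_ne_zero {m : ℤ} (hm : m ≠ 0) : ∫ x : 𝕋, fourier m x = 0 :=
  integral_eq_zero_of_add_right_eq_neg (fourier_add_half_inv_index hm one_pos)

theorem integral_fourier_two_pow_mul {μ : Measure 𝕋} (hμ : MeasurePreserving T μ μ)
    (m : ℤ) (k : ℕ) : ∫ x, fourier (2 ^ k * m) x ∂μ = ∫ x, fourier m x ∂μ := by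
  induction k with
  | zero => simp
  | succ k ih =>
    rw [← ih]
    conv_rhs => rw [← hμ.map_eq]
    rw [integral_map hμ.measurable.aemeasurable
      (fourier (T := 1) (2 ^ k * m)).continuous.aestronglyMeasurable]
    refine integral_congr_ae (.of_forall fun x => ?_)
    simp only [fourier_apply, T, ← natCast_zsmul, smul_smul]
    congr 3
    push_cast
    ring

theorem sq_norm_integral_le {μ : Measure 𝕋} [IsProbabilityMeasure μ] (f : C(𝕋, ℂ)) :
    ‖∫ x, f x ∂μ‖ ^ 2 ≤ ∫ x, ‖f x‖ ^ 2 ∂μ := by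
  have hint : ∀ g : 𝕋 → ℝ, Continuous g → Integrable g μ := fun g hg =>
    hg.integrable_of_hasCompactSupport (HasCompactSupport.of_compactSpace g)
  calc ‖∫ x, f x ∂μ‖ ^ 2 ≤ (∫ x, ‖f x‖ ∂μ) ^ 2 := by
        gcongr
        exact norm_integral_le_integral_norm _
    _ ≤ ∫ x, ‖f x‖ ^ 2 ∂μ :=
        (convexOn_pow 2).map_integral_le (by fun_prop) isClosed_Ici
          (.of_forall fun x => norm_nonneg (f x)) (hint _ (by fun_prop)) (hint _ (by fun_prop))

/-- The Birkhoff sum of length `n` of the character `fourier m` along the doubling map. -/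
def doublingSum (n : ℕ) (m : ℤ) : C(𝕋, ℂ) := ∑ k ∈ Finset.range n, fourier (2 ^ k * m)

theorem integrable_fourier (μ : Measure 𝕋) [IsFiniteMeasure μ] (m : ℤ) :
    Integrable (fun x => fourier m x) μ :=
  (fourier m).continuous.integrable_of_hasCompactSupport (HasCompactSupport.of_compactSpace _)

theorem integral_doublingSum {μ : Measure 𝕋} [IsFiniteMeasure μ] (hμ : MeasurePreserving T μ μ)
    (n : ℕ) (m : ℤ) : ∫ x, doublingSum n m x ∂μ = n * ∫ x, fourier m x ∂μ := by
  simp only [doublingSum, ContinuousMap.coe_sum, Finset.sum_apply]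
  rw [integral_finsetSum _ fun k _ => integrable_fourier μ _]
  simp_rw [integral_fourier_two_pow_mul hμ]
  rw [Finset.sum_const, Finset.card_range, nsmul_eq_mul]

theorem integral_sq_norm_doublingSum (n : ℕ) {m : ℤ} (hm : m ≠ 0) :
    ∫ x, ‖doublingSum n m x‖ ^ 2 = (n : ℝ) := by
  have expand : ∀ x : 𝕋, ((‖doublingSum n m x‖ ^ 2 : ℝ) : ℂ) =
      ∑ j ∈ Finset.range n, ∑ k ∈ Finset.range n, fourier (2 ^ j * m + -(2 ^ k * m)) x := by
    intro x
    simp only [fourier_add, fourier_neg, ← Finset.mul_sum, ← Finset.sum_mul, ← map_sum]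
    rw [Complex.mul_conj', doublingSum, ContinuousMap.coe_sum, Finset.sum_apply]
    push_cast
    rfl
  have orth : ∀ j k : ℕ, ∫ x : 𝕋, fourier (2 ^ j * m + -(2 ^ k * m)) x =
      if j = k then (1 : ℂ) else 0 := by
    intro j k
    split_ifs with h
    · simp [h]
    · refine integral_fourier_of_ne_zero fun h0 => h ?_
      have : (2 : ℤ) ^ j = 2 ^ k := mul_right_cancel₀ hm (by linarith)
      exact Nat.pow_right_injective le_rfl (by exact_mod_cast this)
  have key : ((∫ x, ‖doublingSum n m x‖ ^ 2 : ℝ) : ℂ) = n := by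
    rw [← integral_complex_ofReal]
    simp_rw [expand]
    rw [integral_finsetSum _ fun j _ => integrable_finsetSum _ fun k _ => integrable_fourier _ _]
    simp_rw [integral_finsetSum _ fun k _ => integrable_fourier _ _, orth]
    rw [Finset.sum_congr rfl fun j hj => by rw [Finset.sum_ite_eq, if_pos hj]]
    simp
  exact_mod_cast key

theorem tendsto_haar_of_tendsto_integral_fourier {ι : Type*} {l : Filter ι}
    {μ : ι → ProbabilityMeasure 𝕋}
    (h : ∀ m : ℤ, m ≠ 0 → Tendsto (fun i => ∫ x, fourier m x ∂(μ i : Measure 𝕋)) l (𝓝 0)) :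
    Tendsto μ l (𝓝 ⟨volume, inferInstance⟩) := by
  let e := BoundedContinuousFunction.toContinuousMapStarₐ (α := 𝕋) (β := ℂ) ℂ
  refine ProbabilityMeasure.tendsto_of_tight_of_separatesPoints ℂ .of_compactSpace
    (A := (fourierSubalgebra (T := 1)).comap e) ?_ ?_
  · intro x y hxy
    obtain ⟨_, ⟨f, hf, rfl⟩, hne⟩ := fourierSubalgebra_separatesPoints hxy
    exact ⟨f, ⟨f, ⟨.mkOfCompact f, hf, rfl⟩, rfl⟩, hne⟩
  · intro g hg
    have hg' : e g ∈ Submodule.span ℂ (Set.range (fourier (T := 1))) := by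
      rw [← fourierSubalgebra_coe]
      exact hg
    change Tendsto (fun i => ∫ x, e g x ∂(μ i : Measure 𝕋)) l (𝓝 (∫ x, e g x))
    have hint : ∀ (ν : Measure 𝕋) [IsFiniteMeasure ν] (f : C(𝕋, ℂ)), Integrable f ν :=
      fun ν _ f => f.continuous.integrable_of_hasCompactSupport (.of_compactSpace _)
    generalize e g = f at hg' ⊢
    induction hg' using Submodule.span_induction with
    | mem f hf =>
      obtain ⟨m, rfl⟩ := hf
      rcases eq_or_ne m 0 with rfl | hm
      · simpa using tendsto_const_nhds
      · rw [integral_fourier_of_ne_zero hm]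
        exact h m hm
    | zero => simpa using tendsto_const_nhds
    | add f f' _ _ hf hf' =>
      simp only [ContinuousMap.add_apply]
      simp_rw [fun i => integral_add (hint (μ i) f) (hint (μ i) f'),
        integral_add (hint volume f) (hint volume f')]
      exact hf.add hf'
    | smul c f _ hf =>
      simp only [ContinuousMap.smul_apply, integral_smul]
      exact hf.const_smul c

theorem tendsto_levyProkhorovDist {ι : Type*} {l : Filter ι} {μ : ι → ProbabilityMeasure 𝕋}
    {ν : ProbabilityMeasure 𝕋} (h : Tendsto μ l (𝓝 ν)) :
    Tendsto (fun i => levyProkhorovDist (μ i : Measure 𝕋) ν) l (𝓝 0) := by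
  have := tendsto_iff_dist_tendsto_zero.mp
    ((LevyProkhorov.continuous_ofMeasure_probabilityMeasure.tendsto ν).comp h)
  simpa [LevyProkhorov.dist_probabilityMeasure_def] using this

/-- A probability measure far from Haar measure has a Fourier coefficient of bounded frequency
that is bounded away from zero. -/
theorem exists_bound_integral_fourier {δ : ℝ} (hδ : 0 < δ) :
    ∃ N : ℕ, ∀ μ : ProbabilityMeasure 𝕋,
      δ ≤ levyProkhorovDist (μ : Measure 𝕋) (volume : Measure 𝕋) →
      ∃ m ∈ (Finset.Icc (-N : ℤ) N).erase 0,
        1 / ((N : ℝ) + 1) ≤ ‖∫ x, fourier m x ∂(μ : Measure 𝕋)‖ := by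
  by_contra! hcon
  choose μ hμ hsmall using hcon
  have hlim : Tendsto μ atTop (𝓝 ⟨volume, inferInstance⟩) := by
    refine tendsto_haar_of_tendsto_integral_fourier fun m hm => ?_
    refine squeeze_zero_norm' ?_ tendsto_one_div_add_atTop_nhds_zero_nat
    filter_upwards [eventually_ge_atTop m.natAbs] with N hN
    refine (hsmall N m ?_).le
    simp only [Finset.mem_erase, Finset.mem_Icc]
    exact ⟨hm, by omega, by omega⟩
  exact hδ.not_ge (ge_of_tendsto' (tendsto_levyProkhorovDist hlim) hμ)

theorem le_integral_of_mem_closure_convexCombinations {K : Set (ProbabilityMeasure 𝕋)}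
    {F : 𝕋 → ℝ} (hF : Continuous F) {c : ℝ} (hK : ∀ μ ∈ K, c ≤ ∫ x, F x ∂(μ : Measure 𝕋))
    {ν : ProbabilityMeasure 𝕋} (hν : ν ∈ closure (convexCombinations K)) :
    c ≤ ∫ x, F x ∂(ν : Measure 𝕋) := by
  have hclosed : IsClosed {ν : ProbabilityMeasure 𝕋 | c ≤ ∫ x, F x ∂(ν : Measure 𝕋)} :=
    isClosed_le continuous_const <| continuous_iff_continuousAt.mpr fun ν =>
      ProbabilityMeasure.tendsto_iff_forall_integral_tendsto.mp tendsto_id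
        (BoundedContinuousFunction.mkOfCompact ⟨F, hF⟩)
  refine closure_minimal ?_ hclosed hν
  rintro ν ⟨k, w, μs, hμs, hw, hν⟩
  have hw_top : ∀ i, w i ≠ ⊤ := fun i => ne_top_of_le_ne_top ENNReal.one_ne_top
    (hw ▸ Finset.single_le_sum (fun _ _ => zero_le) (Finset.mem_univ i))
  have hw_real : ∑ i, (w i).toReal = 1 := by
    rw [← ENNReal.toReal_sum fun i _ => hw_top i, hw, ENNReal.toReal_one]
  have hint : ∀ i, Integrable F (w i • (μs i : Measure 𝕋)) := fun i =>
    (hF.integrable_of_hasCompactSupport (.of_compactSpace _)).smul_measure (hw_top i)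
  simp only [Set.mem_ofPred_eq]
  rw [hν, integral_finsetSum_measure fun i _ => hint i]
  simp only [integral_smul_measure, smul_eq_mul]
  calc c = ∑ i, (w i).toReal * c := by rw [← Finset.sum_mul, hw_real, one_mul]
    _ ≤ _ := Finset.sum_le_sum fun i _ =>
      mul_le_mul_of_nonneg_left (hK _ (hμs i)) ENNReal.toReal_nonneg

/-- For every `δ > 0`, the Haar measure is not in the closed convex hull (in the topology
of weak convergence) of the set of invariant probability measures at Lévy–Prokhorov
distance at least `δ` from it. -/
theorem haar_not_in_closed_hull (δ : ℝ) (hδ : 0 < δ) :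
    (⟨volume, inferInstance⟩ : ProbabilityMeasure 𝕋) ∉
      closure (convexCombinations
        {μ : ProbabilityMeasure 𝕋 | InvariantMeasure (μ : Measure 𝕋) ∧
          δ ≤ levyProkhorovDist (μ : Measure 𝕋) (volume : Measure 𝕋)}) := by
  intro hmem
  obtain ⟨N, hN⟩ := exists_bound_integral_fourier hδ
  set s := (Finset.Icc (-N : ℤ) N).erase 0
  set ε : ℝ := 1 / ((N : ℝ) + 1)
  have hε : 0 < ε := by positivity
  have hint : ∀ (ν : Measure 𝕋) [IsFiniteMeasure ν] (n : ℕ) (m : ℤ),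
      Integrable (fun x => ‖doublingSum n m x‖ ^ 2) ν := fun ν _ n m =>
    Continuous.integrable_of_hasCompactSupport (by fun_prop) (.of_compactSpace _)
  have bound : ∀ n : ℕ, (n * ε) ^ 2 ≤ s.card * (n : ℝ) := by
    intro n
    have hle := le_integral_of_mem_closure_convexCombinations
      (F := fun x => ∑ m ∈ s, ‖doublingSum n m x‖ ^ 2) (by fun_prop) (c := (n * ε) ^ 2) ?_ hmem
    · refine hle.trans_eq ?_
      rw [ProbabilityMeasure.coe_mk, integral_finsetSum _ fun m _ => hint _ n m,
        Finset.sum_congr rfl fun m hm =>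
          integral_sq_norm_doublingSum n (Finset.ne_of_mem_erase hm),
        Finset.sum_const, nsmul_eq_mul]
    · rintro μ ⟨⟨hT, -⟩, hμ⟩
      obtain ⟨m, hm, hle⟩ := hN μ hμ
      rw [integral_finsetSum _ fun m _ => hint _ n m]
      calc (n * ε) ^ 2 ≤ ‖∫ x, doublingSum n m x ∂(μ : Measure 𝕋)‖ ^ 2 := by
            rw [integral_doublingSum hT, norm_mul, Complex.norm_natCast]
            gcongr
        _ ≤ ∫ x, ‖doublingSum n m x‖ ^ 2 ∂(μ : Measure 𝕋) := sq_norm_integral_le _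
        _ ≤ _ := Finset.single_le_sum
            (f := fun m => ∫ x, ‖doublingSum n m x‖ ^ 2 ∂(μ : Measure 𝕋))
            (fun _ _ => integral_nonneg fun _ => by positivity) hm
  obtain ⟨n, hn⟩ := exists_nat_gt (s.card / ε ^ 2)
  rw [div_lt_iff₀ (by positivity)] at hn
  have hn0 : (0 : ℝ) < n := by
    by_contra! h0
    have : (n : ℝ) * ε ^ 2 ≤ 0 := mul_nonpos_of_nonpos_of_nonneg h0 (by positivity)
    linarith [(Nat.cast_nonneg s.card : (0 : ℝ) ≤ s.card)]
  nlinarith [bound n, mul_lt_mul_of_pos_right hn hn0]
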